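/- arXiv:2601.13946 — 2 statements merged into one kernel-verified Lean document; each statement's English description precedes it below -/
import Mathlib

section
/- Let W be a set of Borel probability measures on a separable metric space X, let A ⊆ X be open and q ∈ [0,1], with H_0 = {P ∈ W : P(A) ≤ q} and H_1 = {P ∈ W : P(A) > q}. For every α > 0 there exists a sequence of tests φ_n : X^n → {0,1,2} with {φ_n = 0} and {φ_n = 1} open in X^n, such that sup_{P ∈ H_0} ∑_{n=1}^∞ P^n(φ_n ≠ 0) ≤ α, and for every P ∈ H_1, φ_n → 1 P^∞-almost surely, and for every P ∈ H_0, φ_n → 0 P^∞-almost surely. -/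
open MeasureTheory Filter Topology

/-- The number of sample points falling in `B`, as a real number. -/
noncomputable def sampleCount {X : Type*} (B : Set X) {n : ℕ} (x : Fin n → X) : ℝ :=
  ∑ i, B.indicator (fun _ => (1 : ℝ)) (x i)

lemma isOpen_lt_sampleCount {X : Type*} [TopologicalSpace X] {B : Set X} (hB : IsOpen B)
    {n : ℕ} (r : ℝ) : IsOpen {x : Fin n → X | r < sampleCount B x} := by
  have h : LowerSemicontinuous fun x : Fin n → X => sampleCount B x :=
    lowerSemicontinuous_sum fun i _ =>
      LowerSemicontinuous.comp (hB.lowerSemicontinuous_indicator zero_le_one) (continuous_apply i)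
  exact h.isOpen_preimage r

lemma sampleCount_add_le_of_disjoint {X : Type*} {B C : Set X} (h : Disjoint B C) {n : ℕ}
    (x : Fin n → X) : sampleCount B x + sampleCount C x ≤ n := by
  calc sampleCount B x + sampleCount C x
      = ∑ i, (B ∪ C).indicator (fun _ => (1 : ℝ)) (x i) := by
        simp only [sampleCount, ← Finset.sum_add_distrib, Set.indicator_union_of_disjoint h]
    _ ≤ ∑ _i : Fin n, (1 : ℝ) :=
        Finset.sum_le_sum fun i _ => Set.indicator_le_self' (fun _ _ => zero_le_one) _
    _ = n := by simp

/-- Hoeffding's inequality for the lower tail of the number of sample points in a set. -/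
lemma measureReal_sampleCount_le {X : Type*} [MeasurableSpace X] (P : Measure X)
    [IsProbabilityMeasure P] {B : Set X} (hB : MeasurableSet B) (n : ℕ) {c : ℝ} (hc : 0 ≤ c) :
    (Measure.pi fun _ : Fin n => P).real {x | sampleCount B x ≤ n * P.real B - c} ≤
      Real.exp (-2 * c ^ 2 / n) := by
  set f : X → ℝ := fun x => -B.indicator (fun _ => (1 : ℝ)) x with hf
  have hfm : Measurable f := (measurable_const.indicator hB).neg
  have hint : ∫ x, f x ∂P = -P.real B := by
    simp [hf, integral_neg, integral_indicator_const _ hB]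
  have hsub : ProbabilityTheory.HasSubgaussianMGF (fun x => f x - ∫ y, f y ∂P)
      ((‖(0 : ℝ) - (-1)‖₊ / 2) ^ 2) P := by
    refine ProbabilityTheory.hasSubgaussianMGF_of_mem_Icc hfm.aemeasurable (ae_of_all _ fun x => ?_)
    by_cases hx : x ∈ B <;> simp [hf, hx]
  set g : X → ℝ := fun x => f x - ∫ y, f y ∂P with hg
  have hgm : Measurable g := hfm.sub_const _
  have hindep := ProbabilityTheory.iIndepFun_pi (μ := fun _ : Fin n => P) (X := fun _ => g)
    fun _ => hgm.aemeasurable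
  have key := ProbabilityTheory.HasSubgaussianMGF.measure_sum_ge_le_of_iIndepFun hindep
    (s := Finset.univ) (c := fun _ => (‖(0 : ℝ) - (-1)‖₊ / 2) ^ 2) (fun i _ => by
      have hmp := measurePreserving_eval (fun _ : Fin n => P) i
      refine ProbabilityTheory.HasSubgaussianMGF.of_map (X := g)
        (Y := fun x : Fin n → X => x i) hmp.measurable.aemeasurable ?_
      simpa only [hmp.map_eq] using! hsub) hc
  have hset : {x : Fin n → X | sampleCount B x ≤ n * P.real B - c} =
      {x | c ≤ ∑ i, g (x i)} := by
    ext x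
    have : ∑ i, g (x i) = n * P.real B - sampleCount B x := by
      simp only [hg, hint]
      simp [hf, sampleCount, Finset.sum_add_distrib]
      ring
    simp only [Set.mem_ofPred_eq, this]
    constructor <;> intro h <;> linarith
  rw [hset]
  refine key.trans_eq ?_
  congr 1
  rcases Nat.eq_zero_or_pos n with rfl | hn
  · simp
  · have : (n : ℝ) ≠ 0 := by positivity
    simp
    field_simp

/-- Deviations `c n = o(n)` for which the Hoeffding bounds are dominated by a summable sequence
of prescribed total `α`. -/
lemma exists_summable_deviation {α : ℝ} (hα : 0 < α) :
    ∃ c ε : ℕ → ℝ, (∀ n, 0 < c n) ∧ (∀ n, 0 ≤ ε n) ∧ HasSum ε α ∧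
      (∀ n, 0 < n → Real.exp (-2 * c n ^ 2 / n) ≤ ε n) ∧
      ∀ δ > 0, ∀ᶠ n : ℕ in atTop, 2 * c n ≤ δ * n := by
  set a : ℝ := 6 * α / Real.pi ^ 2 with ha
  have ha0 : 0 < a := by positivity
  set ε : ℕ → ℝ := fun n => a * (1 / ((n + 1 : ℕ) : ℝ) ^ 2) with hε
  have hε0 : ∀ n, 0 < ε n := fun n => by positivity
  set L : ℕ → ℝ := fun n => max 1 (-Real.log (ε n)) with hL
  have hL0 : ∀ n, 1 ≤ L n := fun n => le_max_left _ _
  have hlog : Tendsto (fun n : ℕ => L n / ((n + 1 : ℕ) : ℝ)) atTop (𝓝 0) := by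
    have h1 : Tendsto (fun n : ℕ => ((1 + |Real.log a|) + 2 * Real.log ((n + 1 : ℕ) : ℝ)) /
        ((n + 1 : ℕ) : ℝ)) atTop (𝓝 0) := by
      have h2 : Tendsto (fun x : ℝ => ((1 + |Real.log a|) + 2 * Real.log x) / x) atTop (𝓝 0) := by
        have h3 := (tendsto_const_nhds (x := 1 + |Real.log a|)).div_atTop
          (tendsto_id (α := ℝ) (x := atTop))
        have h4 := (Real.isLittleO_log_id_atTop.tendsto_div_nhds_zero).const_mul 2
        have h5 := h3.add h4
        simp only [id, mul_zero, add_zero] at h5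
        refine h5.congr fun x => ?_
        ring
      exact h2.comp (tendsto_natCast_atTop_atTop.comp (tendsto_add_atTop_nat 1))
    refine squeeze_zero (fun n => div_nonneg (zero_le_one.trans (hL0 n)) (by positivity))
      (fun n => ?_) h1
    have hn1 : (1 : ℝ) ≤ ((n + 1 : ℕ) : ℝ) := by push_cast; linarith [n.cast_nonneg (α := ℝ)]
    have hln := Real.log_nonneg hn1
    refine div_le_div_of_nonneg_right (max_le ?_ ?_) (by positivity)
    · linarith [abs_nonneg (Real.log a)]
    · have : Real.log (ε n) = Real.log a - 2 * Real.log ((n + 1 : ℕ) : ℝ) := by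
        rw [hε]
        simp only
        rw [Real.log_mul ha0.ne' (by positivity), one_div, Real.log_inv, Real.log_pow]
        push_cast
        ring
      rw [this]
      linarith [neg_abs_le (Real.log a)]
  have hsq : ∀ n : ℕ, 0 < (n + 1) / 2 * L n := fun n =>
    mul_pos (by positivity) (zero_lt_one.trans_le (hL0 n))
  refine ⟨fun n => √((n + 1) / 2 * L n), ε, fun n => Real.sqrt_pos.2 (hsq n),
    fun n => (hε0 n).le, ?_, fun n hn => ?_, fun δ hδ => ?_⟩
  · have h := (hasSum_nat_add_iff' 1).2 hasSum_zeta_two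
    have h' := h.mul_left a
    have : a * (Real.pi ^ 2 / 6 - ∑ i ∈ Finset.range 1, 1 / ((i : ℕ) : ℝ) ^ 2) = α := by
      rw [ha]; simp; field_simp
    rwa [this] at h'
  · rw [Real.sq_sqrt (hsq n).le]
    have hn' : (0 : ℝ) < n := by exact_mod_cast hn
    calc Real.exp (-2 * ((n + 1) / 2 * L n) / n) ≤ Real.exp (Real.log (ε n)) := by
          refine Real.exp_le_exp.2 ?_
          rw [div_le_iff₀ hn']
          have h1 : -Real.log (ε n) ≤ L n := le_max_right _ _
          nlinarith [hL0 n]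
      _ = ε n := Real.exp_log (hε0 n)
  · have hη : (0 : ℝ) < δ ^ 2 / 8 := by positivity
    filter_upwards [hlog.eventually_lt_const hη, eventually_ge_atTop 1] with n hn hn1
    have hn1' : (1 : ℝ) ≤ n := by exact_mod_cast hn1
    rw [div_lt_iff₀ (by positivity)] at hn
    push_cast at hn
    have : √((n + 1) / 2 * L n) ≤ δ * n / 2 := by
      refine Real.sqrt_le_iff.2 ⟨by positivity, ?_⟩
      have h1 : ((n : ℝ) + 1) / 2 * L n ≤ (n + 1) / 2 * (δ ^ 2 / 8 * (n + 1)) :=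
        mul_le_mul_of_nonneg_left hn.le (by positivity)
      have h2 : ((n : ℝ) + 1) ^ 2 ≤ (2 * n) ^ 2 := by gcongr; linarith
      nlinarith [sq_nonneg δ, mul_le_mul_of_nonneg_left h2 (sq_nonneg δ)]
    linarith

/-- The sample count of `B` exceeds a threshold lying `c` below its mean, except with probability
at most `ε`, where `ε` dominates the Hoeffding bound when `n` is positive. -/
lemma pi_sampleCount_le {X : Type*} [MeasurableSpace X] (P : Measure X)
    [IsProbabilityMeasure P] {B : Set X} (hB : MeasurableSet B) (n : ℕ) {c ε r : ℝ} (hc : 0 < c)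
    (hε : 0 < n → Real.exp (-2 * c ^ 2 / n) ≤ ε) (hr : r ≤ n * P.real B - c) :
    (Measure.pi fun _ : Fin n => P) {x | ¬ r < sampleCount B x} ≤ ENNReal.ofReal ε := by
  rcases Nat.eq_zero_or_pos n with rfl | hn
  · have : {x : Fin 0 → X | ¬ r < sampleCount B x} = ∅ := by
      ext x
      simp only [Nat.cast_zero, zero_mul, zero_sub] at hr
      simp only [sampleCount, Finset.univ_eq_empty, Finset.sum_empty, Set.mem_ofPred_eq,
        Set.mem_empty_iff_false, iff_false, not_not]
      linarith
    rw [this, measure_empty]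
    exact zero_le
  · rw [← ofReal_measureReal]
    refine ENNReal.ofReal_le_ofReal (le_trans (measureReal_mono fun x hx => ?_)
      ((measureReal_sampleCount_le P hB n hc.le).trans (hε hn)))
    exact (not_lt.1 hx).trans hr

/-- Borel–Cantelli along the initial segments of an infinite i.i.d. sample. -/
lemma measure_eventually_eq_one {X : Type*} [MeasurableSpace X] (P : Measure X)
    (μ : Measure (ℕ → X)) [IsProbabilityMeasure μ]
    (hμ : ∀ n : ℕ, Measure.map (fun ω (j : Fin n) => ω (j : ℕ)) μ =
      Measure.pi fun _ : Fin n => P)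
    {S : ∀ n : ℕ, Set (Fin n → X)} {ε : ℕ → ℝ} (hε0 : ∀ n, 0 ≤ ε n) (hε : Summable ε)
    (hS : ∀ᶠ n : ℕ in atTop, (Measure.pi fun _ : Fin n => P) (S n)ᶜ ≤ ENNReal.ofReal (ε n)) :
    μ {ω | ∀ᶠ n in atTop, (fun j : Fin n => ω (j : ℕ)) ∈ S n} = 1 := by
  obtain ⟨N, hN⟩ := eventually_atTop.1 hS
  have hbound : ∀ n, μ {ω | N ≤ n ∧ (fun j : Fin n => ω (j : ℕ)) ∉ S n} ≤
      ENNReal.ofReal (ε n) := by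
    intro n
    by_cases hn : N ≤ n
    · have hm : Measurable fun (ω : ℕ → X) (j : Fin n) => ω (j : ℕ) := by fun_prop
      have h := hN n hn
      rw [← hμ n] at h
      simpa only [hn, true_and] using! (Measure.le_map_apply hm.aemeasurable _).trans h
    · simp [hn]
  have hsum : ∑' n, μ {ω | N ≤ n ∧ (fun j : Fin n => ω (j : ℕ)) ∉ S n} ≠ ⊤ := by
    refine ne_top_of_le_ne_top ?_ (ENNReal.tsum_le_tsum hbound)
    rw [← ENNReal.ofReal_tsum_of_nonneg hε0 hε]
    exact ENNReal.ofReal_ne_top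
  have hae : ∀ᵐ ω ∂μ, ∀ᶠ n in atTop, (fun j : Fin n => ω (j : ℕ)) ∈ S n := by
    filter_upwards [ae_eventually_notMem hsum] with ω hω
    filter_upwards [hω, eventually_ge_atTop N] with n hn hNn
    by_contra hcon
    exact hn ⟨hNn, hcon⟩
  exact (measure_congr (eventuallyEq_univ.2 hae)).trans measure_univ

/-- For the subbasis hypotheses `H₀ = {P ∈ W : P(A) ≤ q}` and `H₁ = {P ∈ W : P(A) > q}`
with `A` open, for every `α > 0` there is an FP-test (open decision regions) whose summed
error under `H₀` is at most `α`, which converges a.s. to `0` under every `P ∈ H₀` and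
a.s. to `1` under every `P ∈ H₁`. -/
theorem stmt_4 {X : Type*} [MetricSpace X] [TopologicalSpace.SeparableSpace X]
    [MeasurableSpace X] [BorelSpace X]
    (W : Set (Measure X)) (hW : ∀ P ∈ W, IsProbabilityMeasure P)
    (A : Set X) (hA : IsOpen A) (q : ℝ) (hq0 : 0 ≤ q) (hq1 : q ≤ 1)
    (α : ℝ) (hα : 0 < α) :
    ∃ φ : ∀ n : ℕ, (Fin n → X) → ℕ,
      (∀ n, Measurable (φ n)) ∧
      (∀ n x, φ n x ≤ 2) ∧
      (∀ n, IsOpen {x : Fin n → X | φ n x = 0}) ∧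
      (∀ n, IsOpen {x : Fin n → X | φ n x = 1}) ∧
      (∀ P ∈ W, P A ≤ ENNReal.ofReal q →
        ∑' n : ℕ, (Measure.pi fun _ : Fin n => P) {x | φ n x ≠ 0} ≤ ENNReal.ofReal α) ∧
      (∀ P ∈ W, P A ≤ ENNReal.ofReal q →
        ∀ μ : Measure (ℕ → X), IsProbabilityMeasure μ →
          (∀ n : ℕ, Measure.map (fun ω (j : Fin n) => ω (j : ℕ)) μ =
            Measure.pi fun _ : Fin n => P) →
          μ {ω | ∀ᶠ n in atTop, φ n (fun j : Fin n => ω (j : ℕ)) = 0} = 1) ∧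
      (∀ P ∈ W, ENNReal.ofReal q < P A →
        ∀ μ : Measure (ℕ → X), IsProbabilityMeasure μ →
          (∀ n : ℕ, Measure.map (fun ω (j : Fin n) => ω (j : ℕ)) μ =
            Measure.pi fun _ : Fin n => P) →
          μ {ω | ∀ᶠ n in atTop, φ n (fun j : Fin n => ω (j : ℕ)) = 1} = 1) := by
  obtain ⟨c, ε, hc, hε0, hsum, hexp, hlit⟩ := exists_summable_deviation hα
  set r : ℕ → ENNReal := fun n => ((n : ENNReal) + 1)⁻¹ with hr
  have hrpos : ∀ n, 0 < r n := fun n => ENNReal.inv_pos.2 (by simp)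
  have hranti : Antitone r := fun m n hmn => ENNReal.inv_le_inv.2 (by gcongr)
  set U : ℕ → Set X := fun n => {x | Metric.infEDist x Aᶜ < r n} with hU
  set V : ℕ → Set X := fun n => {x | r n < Metric.infEDist x Aᶜ} with hV
  have hUo : ∀ n, IsOpen (U n) := fun n =>
    isOpen_lt Metric.continuous_infEDist continuous_const
  have hVo : ∀ n, IsOpen (V n) := fun n =>
    isOpen_lt continuous_const Metric.continuous_infEDist
  have hUV : ∀ n, Disjoint (U n) (V n) := fun n =>
    Set.disjoint_left.2 fun x hx hx' => lt_asymm (show Metric.infEDist x Aᶜ < r n from hx) hx'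
  have hAU : ∀ n, Aᶜ ⊆ U n := fun n x hx => by
    simpa [hU, Metric.infEDist_zero_of_mem hx] using hrpos n
  have hVA : ⋃ n, V n = A := by
    ext x
    simp only [Set.mem_iUnion]
    refine ⟨fun ⟨n, hn⟩ => ?_, fun hx => ?_⟩
    · by_contra hx
      simp [hV, Metric.infEDist_zero_of_mem (show x ∈ Aᶜ from hx)] at hn
    · have hpos : 0 < Metric.infEDist x Aᶜ := by
        rw [pos_iff_ne_zero]
        intro h0
        exact ((Metric.mem_iff_infEDist_zero_of_closed hA.isClosed_compl).2 h0 : x ∈ Aᶜ) hx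
      obtain ⟨n, hn⟩ := ENNReal.exists_inv_nat_lt hpos.ne'
      exact ⟨n, lt_of_le_of_lt (ENNReal.inv_le_inv.2 le_self_add) hn⟩
  have hVmono : Monotone V := fun m n hmn x hx => lt_of_le_of_lt (hranti hmn) hx
  set D₀ : ∀ n : ℕ, Set (Fin n → X) := fun n => {x | n * (1 - q) - c n < sampleCount (U n) x}
    with hD₀
  set D₁ : ∀ n : ℕ, Set (Fin n → X) := fun n => {x | n * q + c n < sampleCount (V n) x} with hD₁
  have hD₀o : ∀ n, IsOpen (D₀ n) := fun n => isOpen_lt_sampleCount (hUo n) _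
  have hD₁o : ∀ n, IsOpen (D₁ n) := fun n => isOpen_lt_sampleCount (hVo n) _
  have hdisj : ∀ n x, x ∈ D₁ n → x ∉ D₀ n := fun n x h1 h0 => by
    have := sampleCount_add_le_of_disjoint (hUV n) x
    simp only [hD₀, hD₁, Set.mem_ofPred_eq] at h0 h1
    linarith
  classical
  set φ : ∀ n : ℕ, (Fin n → X) → ℕ := fun n x => if x ∈ D₀ n then 0 else if x ∈ D₁ n then 1 else 2
    with hφ
  have hφ0 : ∀ n x, φ n x = 0 ↔ x ∈ D₀ n := fun n x => by
    simp only [hφ]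
    split_ifs with h0 h1 <;> simp [h0]
  have hφ1 : ∀ n x, φ n x = 1 ↔ x ∈ D₁ n := fun n x => by
    simp only [hφ]
    split_ifs with h0 h1
    · simpa using fun h1 => hdisj n x h1 h0
    · simp [h1]
    · simp [h1]
  have herr₀ : ∀ P ∈ W, P A ≤ ENNReal.ofReal q → ∀ n : ℕ,
      (Measure.pi fun _ : Fin n => P) (D₀ n)ᶜ ≤ ENNReal.ofReal (ε n) := by
    intro P hP hPA n
    have := hW P hP
    refine pi_sampleCount_le P (hUo n).measurableSet n (hc n) (hexp n) ?_
    have h1 : P.real A ≤ q := ENNReal.toReal_le_of_le_ofReal hq0 hPA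
    have h2 : P.real Aᶜ ≤ P.real (U n) := measureReal_mono (hAU n)
    rw [probReal_compl_eq_one_sub hA.measurableSet] at h2
    have : (n : ℝ) * (1 - q) ≤ n * P.real (U n) := by gcongr; linarith
    linarith
  refine ⟨φ, fun n => ?_, fun n x => ?_, fun n => ?_, fun n => ?_, ?_, ?_, ?_⟩
  · exact Measurable.ite (hD₀o n).measurableSet measurable_const
      (Measurable.ite (hD₁o n).measurableSet measurable_const measurable_const)
  · simp only [hφ]; split_ifs <;> simp
  · simpa only [hφ0] using! hD₀o n
  · simpa only [hφ1] using! hD₁o n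
  · intro P hP hPA
    calc ∑' n : ℕ, (Measure.pi fun _ : Fin n => P) {x | φ n x ≠ 0}
        ≤ ∑' n : ℕ, ENNReal.ofReal (ε n) := ENNReal.tsum_le_tsum fun n => by
          simpa only [ne_eq, hφ0] using! herr₀ P hP hPA n
      _ = ENNReal.ofReal α := by
          rw [← ENNReal.ofReal_tsum_of_nonneg hε0 hsum.summable, hsum.tsum_eq]
  · intro P hP hPA μ hμp hμ
    simp only [hφ0]
    exact measure_eventually_eq_one P μ hμ hε0 hsum.summable
      (Eventually.of_forall (herr₀ P hP hPA))
  · intro P hP hPA μ hμp hμ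
    have := hW P hP
    simp only [hφ1]
    refine measure_eventually_eq_one P μ hμ hε0 hsum.summable ?_
    have hqA : q < P.real A := (ENNReal.ofReal_lt_iff_lt_toReal hq0 (measure_ne_top P A)).1 hPA
    have htend : Tendsto (fun n => P.real (V n)) atTop (𝓝 (P.real A)) := by
      have h := tendsto_measure_iUnion_atTop (μ := P) hVmono
      rw [hVA] at h
      exact (ENNReal.tendsto_toReal (measure_ne_top P A)).comp h
    filter_upwards [htend.eventually_const_lt (show (q + P.real A) / 2 < P.real A by linarith),
      hlit ((P.real A - q) / 2) (by linarith)] with n hn hcn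
    refine pi_sampleCount_le P (hVo n).measurableSet n (hc n) (hexp n) ?_
    have : (n : ℝ) * ((q + P.real A) / 2) ≤ n * P.real (V n) := by gcongr
    linarith
end

section
/- Suppose there exists a weakly consistent FP-testing sequence (φ_n) for hypotheses H_0, H_1 with sup_{P∈H_0} P^n(φ_n = 1) ≤ α < 1/2 uniformly for all large n, and similarly P^n(φ_n = 0) small under H_1 eventually. Then the block majority-vote test ψ_n satisfies lim_n sup_{P∈H_0} ∑_{m ≥ n} P^m(ψ_m ≠ 0) = 0. -/
open MeasureTheory Filter Topology

/-- block length `k_n = ⌊log n⌋` -/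
noncomputable def kk (n : ℕ) : ℕ := ⌊Real.log n⌋₊

/-- number of blocks `m_n = ⌊n / k_n⌋` -/
noncomputable def mm (n : ℕ) : ℕ := n / kk n

open Classical in
/-- The block majority-vote test `ψ_n` built from `φ`. -/
noncomputable def blockPsi {X : Type*} (φ : ∀ n : ℕ, (Fin n → X) → ℕ)
    (n : ℕ) (ω : ℕ → X) : ℕ :=
  if (1 / 2 : ℝ) < (mm n : ℝ)⁻¹ * ∑ j ∈ Finset.range (mm n),
      (if φ (kk n) (fun t : Fin (kk n) => ω (kk n * j + (t : ℕ))) = 0 then (1 : ℝ) else 0)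
    then 0
  else if (1 / 2 : ℝ) < (mm n : ℝ)⁻¹ * ∑ j ∈ Finset.range (mm n),
      (if φ (kk n) (fun t : Fin (kk n) => ω (kk n * j + (t : ℕ))) = 1 then (1 : ℝ) else 0)
    then 1
  else 2

open ProbabilityTheory in
/-- **Hoeffding's inequality** for the frequency of an event in an i.i.d. sequence. -/
lemma infinitePi_real_half_le_sum_indicator_le {Y : Type*} [MeasurableSpace Y]
    (ν : Measure Y) [IsProbabilityMeasure ν] {S : Set Y} (hS : MeasurableSet S)
    {δ : ℝ} (hδ : 0 ≤ δ) (hνS : ν.real S ≤ 1 / 2 - δ) (M : ℕ) :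
    (Measure.infinitePi fun _ : ℕ => ν).real
      {y | (M : ℝ) / 2 ≤ ∑ j ∈ Finset.range M, S.indicator 1 (y j)} ≤
      Real.exp (-(2 * δ ^ 2 * M)) := by
  have hf : Measurable (S.indicator (1 : Y → ℝ)) := measurable_one.indicator hS
  set f : Y → ℝ := S.indicator 1 with hfdef
  have hindep : iIndepFun (fun (j : ℕ) (y : ℕ → Y) => f (y j) - ν.real S)
      (Measure.infinitePi fun _ : ℕ => ν) :=
    iIndepFun_infinitePi (X := fun _ y => f y - ν.real S) fun _ => hf.sub_const _
  have hmean (j : ℕ) : ∫ y : ℕ → Y, f (y j) ∂(Measure.infinitePi fun _ : ℕ => ν) = ν.real S := by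
    have hmap := measurePreserving_eval_infinitePi (fun _ : ℕ => ν) j
    have hint := integral_map hmap.aemeasurable (f := f) hf.aestronglyMeasurable
    rw [hmap.map_eq, integral_indicator_one hS] at hint
    exact hint.symm
  have hsub (j : ℕ) : HasSubgaussianMGF (fun y : ℕ → Y => f (y j) - ν.real S)
      ((‖(1 : ℝ) - 0‖₊ / 2) ^ 2) (Measure.infinitePi fun _ : ℕ => ν) := by
    rw [← hmean j]
    refine hasSubgaussianMGF_of_mem_Icc (X := fun y : ℕ → Y => f (y j))
      (hf.comp (measurable_pi_apply j)).aemeasurable (.of_forall fun y => ?_)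
    by_cases hy : y j ∈ S <;> simp [hfdef, hy]
  refine (measureReal_mono ?_).trans ((HasSubgaussianMGF.measure_sum_range_ge_le_of_iIndepFun
    hindep (n := M) (fun j _ => hsub j) (ε := M * δ) (by positivity)).trans_eq ?_)
  · intro y hy
    simp only [Set.mem_ofPred_eq, Finset.sum_sub_distrib, Finset.sum_const, Finset.card_range,
      nsmul_eq_mul] at hy ⊢
    nlinarith [mul_le_mul_of_nonneg_left hνS (Nat.cast_nonneg (α := ℝ) M)]
  · congr 1
    rcases Nat.eq_zero_or_pos M with rfl | hM
    · simp
    · have : (M : ℝ) ≠ 0 := by positivity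
      simp
      field_simp

/-- A measure on sequences all of whose initial marginals are products of `P` is the infinite
product of `P`. -/
lemma eq_infinitePi_of_map_eq_pi {X : Type*} [MeasurableSpace X] {P : Measure X}
    [IsProbabilityMeasure P] {μ : Measure (ℕ → X)}
    (h : ∀ m : ℕ, Measure.map (fun ω (j : Fin m) => ω (j : ℕ)) μ =
      Measure.pi fun _ : Fin m => P) :
    μ = Measure.infinitePi fun _ : ℕ => P := by
  classical
  refine Measure.eq_infinitePi _ fun s t ht => ?_
  obtain ⟨m, hm⟩ := s.exists_nat_subset_range
  have hset : (Set.pi s t : Set (ℕ → X)) = (fun ω (j : Fin m) => ω (j : ℕ)) ⁻¹'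
      Set.univ.pi fun j : Fin m => if (j : ℕ) ∈ s then t j else Set.univ := by
    ext ω
    simp only [Set.mem_pi, Finset.mem_coe, Set.mem_preimage, Set.mem_univ, forall_const]
    refine ⟨fun hω j => ?_, fun hω i hi => ?_⟩
    · split_ifs with hj
      exacts [hω _ hj, trivial]
    · simpa [hi] using hω ⟨i, Finset.mem_range.1 (hm hi)⟩
  rw [hset, ← Measure.map_apply (by fun_prop) (.univ_pi fun j => by split_ifs <;> simp [ht]),
    h m, Measure.pi_pi,
    Fin.prod_univ_eq_prod_range (fun j => P (if j ∈ s then t j else Set.univ)) m]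
  refine (Finset.prod_subset_one_on_sdiff hm (fun i hi => ?_) fun i hi => ?_).symm
  · simp [(Finset.mem_sdiff.1 hi).2]
  · simp [hi]

/-- Cutting an i.i.d. sequence into consecutive blocks of length `k` gives an i.i.d. sequence of
blocks. -/
lemma infinitePi_map_blocks {X : Type*} [MeasurableSpace X] (P : Measure X)
    [IsProbabilityMeasure P] (k : ℕ) :
    (Measure.infinitePi fun _ : ℕ => P).map (fun ω (j : ℕ) (t : Fin k) => ω (k * j + t)) =
      Measure.infinitePi fun _ : ℕ => Measure.pi fun _ : Fin k => P := by
  have hinj : Function.Injective fun p : ℕ × Fin k => k * p.1 + (p.2 : ℕ) := by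
    rintro ⟨a, b⟩ ⟨c, d⟩ h
    have hk : 0 < k := b.pos
    have h1 := congrArg (· / k) h
    have h2 := congrArg (· % k) h
    simp only [Nat.mul_add_div hk, Nat.div_eq_of_lt b.2, Nat.div_eq_of_lt d.2, add_zero] at h1
    simp only [Nat.mul_add_mod, Nat.mod_eq_of_lt b.2, Nat.mod_eq_of_lt d.2] at h2
    exact Prod.ext h1 (Fin.ext h2)
  have hcurry := Measure.infinitePi_map_curry (fun (_ : ℕ) (_ : Fin k) => P)
  rw [← Measure.map_infinitePi_infinitePi_of_inj (P := fun _ : ℕ => P) hinj,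
    Measure.map_map (by fun_prop) (by fun_prop)] at hcurry
  simp only [Measure.infinitePi_eq_pi] at hcurry
  exact hcurry

/-- If the error probability of `φ` on a block is at most `1 / 2 - δ`, the majority vote errs with
probability at most `exp (-2 δ² m_n)`. -/
lemma measure_blockPsi_ne_zero_le {X : Type*} [MeasurableSpace X]
    {φ : ∀ n : ℕ, (Fin n → X) → ℕ} (hmeas : ∀ n, Measurable (φ n))
    (P : Measure X) [IsProbabilityMeasure P] {δ : ℝ} (hδ : 0 ≤ δ) {n : ℕ}
    (hn : (Measure.pi fun _ : Fin (kk n) => P).real {x | φ (kk n) x ≠ 0} ≤ 1 / 2 - δ) :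
    (Measure.infinitePi fun _ : ℕ => P) {ω | blockPsi φ n ω ≠ 0} ≤
      ENNReal.ofReal (Real.exp (-(2 * δ ^ 2 * mm n))) := by
  have hS : MeasurableSet {x | φ (kk n) x ≠ 0} :=
    hmeas _ (measurableSet_singleton 0).compl
  have hoeff := infinitePi_real_half_le_sum_indicator_le _ hS hδ hn (mm n)
  rw [← infinitePi_map_blocks, map_measureReal_apply (by fun_prop)] at hoeff
  · refine le_trans (measure_mono ?_) ((ENNReal.le_ofReal_iff_toReal_le
      (measure_ne_top _ _) (by positivity)).2 hoeff)
    intro ω hω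
    simp only [Set.mem_preimage, Set.mem_ofPred_eq] at hω ⊢
    rcases Nat.eq_zero_or_pos (mm n) with h0 | hpos
    · simp [h0]
    have hle : ¬ (1 / 2 : ℝ) < (mm n : ℝ)⁻¹ * ∑ j ∈ Finset.range (mm n),
        (if φ (kk n) (fun t : Fin (kk n) => ω (kk n * j + (t : ℕ))) = 0 then (1 : ℝ) else 0) := by
      intro hlt
      refine hω ?_
      unfold blockPsi
      rw [if_pos (by convert hlt)]
    have hM : (0 : ℝ) < mm n := by exact_mod_cast hpos
    rw [not_lt, inv_mul_le_iff₀ hM] at hle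
    have hsum : ∑ j ∈ Finset.range (mm n), {x | φ (kk n) x ≠ 0}.indicator (1 : (Fin (kk n) → X) → ℝ)
        (fun t : Fin (kk n) => ω (kk n * j + (t : ℕ))) = mm n - ∑ j ∈ Finset.range (mm n),
        (if φ (kk n) (fun t : Fin (kk n) => ω (kk n * j + (t : ℕ))) = 0 then (1 : ℝ) else 0) := by
      rw [eq_sub_iff_add_eq, ← Finset.sum_add_distrib]
      trans ∑ j ∈ Finset.range (mm n), (1 : ℝ)
      · refine Finset.sum_congr rfl fun j _ => ?_
        by_cases hj : φ (kk n) (fun t : Fin (kk n) => ω (kk n * j + (t : ℕ))) = 0 <;>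
          simp [Set.indicator, hj]
      · simp
    rw [hsum]
    linarith
  · exact measurableSet_le measurable_const (Finset.measurable_sum _ fun j _ =>
      (measurable_one.indicator hS).comp (measurable_pi_apply j))

lemma tendsto_kk_atTop : Tendsto kk atTop atTop :=
  tendsto_nat_floor_atTop.comp (Real.tendsto_log_atTop.comp tendsto_natCast_atTop_atTop)

/-- The number of blocks eventually dominates any multiple of `log n`. -/
lemma eventually_two_mul_log_le_mul_mm {c : ℝ} (hc : 0 < c) :
    ∀ᶠ n : ℕ in atTop, 2 * Real.log n ≤ c * mm n := by
  have h2 := (Real.isLittleO_pow_log_id_atTop (n := 2)).bound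
    (show (0 : ℝ) < c / (2 + c) by positivity)
  have hlog : ∀ᶠ n : ℕ in atTop, 1 ≤ Real.log n :=
    (Real.tendsto_log_atTop.comp tendsto_natCast_atTop_atTop).eventually_ge_atTop 1
  filter_upwards [tendsto_natCast_atTop_atTop.eventually h2, hlog] with n hn hl
  have hk : 0 < kk n := Nat.floor_pos.2 hl
  have hkl : (kk n : ℝ) ≤ Real.log n := Nat.floor_le (by linarith)
  have hdiv : (n : ℝ) < kk n * (mm n + 1) := by
    exact_mod_cast Nat.lt_mul_div_succ n hk
  have hdiv' : (n : ℝ) ≤ Real.log n * (mm n + 1) :=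
    hdiv.le.trans (mul_le_mul_of_nonneg_right hkl (by positivity))
  simp only [id, norm_pow, Real.norm_eq_abs, sq_abs, Nat.abs_cast] at hn
  rw [div_mul_eq_mul_div, le_div_iff₀ (by positivity)] at hn
  have hmul : (2 * Real.log n + c) * Real.log n ≤ c * (mm n + 1) * Real.log n := by
    nlinarith [mul_le_mul_of_nonneg_left hdiv' hc.le,
      mul_le_mul_of_nonneg_left hl (mul_nonneg hc.le (zero_le_one.trans hl))]
  linarith [le_of_mul_le_mul_right hmul (by linarith)]

lemma tsum_ite_le_eq_tsum_add (f : ℕ → ENNReal) (n : ℕ) :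
    ∑' m, (if n ≤ m then f m else 0) = ∑' m, f (m + n) := by
  rw [← Summable.sum_add_tsum_nat_add' (k := n) ENNReal.summable, Finset.sum_eq_zero, zero_add]
  · simp
  · intro i hi
    simp [Finset.mem_range.1 hi]

/-- If `φ` is a weakly consistent FP-test with a uniform error bound `α < 1/2` under `H₀`
(and similarly under `H₁`) for all large `n`, then the block majority-vote test `ψ`
satisfies `lim_n sup_{P ∈ H₀} ∑_{m ≥ n} P^m(ψ_m ≠ 0) = 0`. -/
theorem stmt_6 {X : Type*} [MetricSpace X] [TopologicalSpace.SeparableSpace X]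
    [MeasurableSpace X] [BorelSpace X]
    (H0 H1 : Set (Measure X)) (hprob : ∀ P ∈ H0 ∪ H1, IsProbabilityMeasure P)
    (φ : ∀ n : ℕ, (Fin n → X) → ℕ)
    (hmeas : ∀ n, Measurable (φ n)) (hval : ∀ n x, φ n x ≤ 2)
    (hopen0 : ∀ n, IsOpen {x : Fin n → X | φ n x = 0})
    (hopen1 : ∀ n, IsOpen {x : Fin n → X | φ n x = 1})
    (hcons0 : ∀ P ∈ H0, Tendsto
      (fun n => (Measure.pi fun _ : Fin n => P) {x | φ n x = 0}) atTop (𝓝 1))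
    (hcons1 : ∀ P ∈ H1, Tendsto
      (fun n => (Measure.pi fun _ : Fin n => P) {x | φ n x = 1}) atTop (𝓝 1))
    (α : ℝ) (hα : α < 1 / 2)
    (N : ℕ)
    (hunif0 : ∀ n ≥ N, ∀ P ∈ H0,
      (Measure.pi fun _ : Fin n => P) {x | φ n x ≠ 0} ≤ ENNReal.ofReal α)
    (hunif1 : ∀ n ≥ N, ∀ P ∈ H1,
      (Measure.pi fun _ : Fin n => P) {x | φ n x ≠ 1} ≤ ENNReal.ofReal α) :
    ∀ ε > (0 : ℝ), ∃ N' : ℕ, ∀ n ≥ N', ∀ P ∈ H0,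
      ∀ μ : Measure (ℕ → X), IsProbabilityMeasure μ →
        (∀ m : ℕ, Measure.map (fun ω (j : Fin m) => ω (j : ℕ)) μ =
          Measure.pi fun _ : Fin m => P) →
        ∑' m : ℕ, (if n ≤ m then μ {ω | blockPsi φ m ω ≠ 0} else 0) ≤
          ENNReal.ofReal ε := by
  intro ε hε
  set δ : ℝ := 1 / 2 - max α 0 with hδdef
  have hδ : 0 < δ := sub_pos.2 (max_lt hα (by norm_num))
  have hsum : ∑' m : ℕ, ENNReal.ofReal (((m : ℝ) ^ 2)⁻¹) ≠ ⊤ :=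
    (Real.summable_nat_pow_inv.2 one_lt_two).tsum_ofReal_ne_top
  have htail := (ENNReal.tendsto_sum_nat_add _ hsum).eventually_le_const
    (ENNReal.ofReal_pos.2 hε)
  have hgrowth := eventually_two_mul_log_le_mul_mm (show 0 < 2 * δ ^ 2 by positivity)
  obtain ⟨N', hN'⟩ := eventually_atTop.1 (htail.and (eventually_forall_ge_atTop.2
    (hgrowth.and ((tendsto_kk_atTop.eventually_ge_atTop N).and (eventually_gt_atTop 0)))))
  refine ⟨N', fun n hn P hP μ _ hμ => ?_⟩
  have := hprob P (.inl hP)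
  obtain rfl := eq_infinitePi_of_map_eq_pi hμ
  obtain ⟨hnε, hnall⟩ := hN' n hn
  rw [tsum_ite_le_eq_tsum_add]
  refine (ENNReal.tsum_le_tsum fun m => ?_).trans hnε
  obtain ⟨hlog, hkN, hpos⟩ := hnall (m + n) (Nat.le_add_left n m)
  have herr : (Measure.pi fun _ : Fin (kk (m + n)) => P).real
      {x | φ (kk (m + n)) x ≠ 0} ≤ 1 / 2 - δ := by
    rw [hδdef, sub_sub_cancel]
    refine ENNReal.toReal_le_of_le_ofReal (le_max_right _ _) ?_
    exact (hunif0 _ hkN P hP).trans (ENNReal.ofReal_le_ofReal (le_max_left _ _))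
  refine (measure_blockPsi_ne_zero_le hmeas P hδ.le herr).trans (ENNReal.ofReal_le_ofReal ?_)
  have hpos' : (0 : ℝ) < (m + n : ℕ) := by exact_mod_cast hpos
  calc Real.exp (-(2 * δ ^ 2 * mm (m + n)))
      ≤ Real.exp (-(2 * Real.log (m + n : ℕ))) := Real.exp_le_exp.2 (neg_le_neg hlog)
    _ = (((m + n : ℕ) : ℝ) ^ 2)⁻¹ := by
      rw [Real.exp_neg, two_mul, Real.exp_add, Real.exp_log hpos', sq]
end
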